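/- For all integers n and k with n ≥ k ≥ 4, the outerplanar Turán number of the path P_k satisfies ex_OP(n, P_k) = max{ex'_OP(n, P_k), ex''_OP(n, P_k)}, where ex'_OP(n,P_k) is the maximum number of edges in a connected P_k-free outerplanar graph on n vertices and ex''_OP(n,P_k) is the maximum number of edges in a P_k-free outerplanar graph on n vertices in which every connected component has at most k−1 vertices. -/

import Mathlib

/-- A simple graph is outerplanar if it admits a one-page book embedding:
an injective integer labeling of the vertices such that no two edges interleave. -/
def IsOuterplanar {V : Type*} (G : SimpleGraph V) : Prop :=
  ∃ f : V → ℤ, Function.Injective f ∧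
    ∀ a b c d : V, G.Adj a b → G.Adj c d →
      ¬(f a < f c ∧ f c < f b ∧ f b < f d)

/-- `G` contains a subgraph isomorphic to `H`. -/
def ContainsCopy {W V : Type*} (H : SimpleGraph W) (G : SimpleGraph V) : Prop :=
  ∃ φ : H →g G, Function.Injective φ

/-- The outerplanar Turán number: maximum number of edges of an `H`-free
outerplanar graph on `n` vertices. -/
noncomputable def exOP (n : ℕ) {W : Type*} (H : SimpleGraph W) : ℕ :=
  sSup {m : ℕ | ∃ G : SimpleGraph (Fin n),
    IsOuterplanar G ∧ ¬ ContainsCopy H G ∧ m = G.edgeSet.ncard}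

/-- The maximum number of edges of a connected `H`-free outerplanar graph on `n` vertices. -/
noncomputable def exOP' (n : ℕ) {W : Type*} (H : SimpleGraph W) : ℕ :=
  sSup {m : ℕ | ∃ G : SimpleGraph (Fin n),
    IsOuterplanar G ∧ G.Connected ∧ ¬ ContainsCopy H G ∧ m = G.edgeSet.ncard}

/-- The maximum number of edges of an `H`-free outerplanar graph on `n` vertices
all of whose connected components have at most `k - 1` vertices. -/
noncomputable def exOP'' (n k : ℕ) {W : Type*} (H : SimpleGraph W) : ℕ :=
  sSup {m : ℕ | ∃ G : SimpleGraph (Fin n),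
    IsOuterplanar G ∧ (∀ c : G.ConnectedComponent, c.supp.ncard ≤ k - 1) ∧
    ¬ ContainsCopy H G ∧ m = G.edgeSet.ncard}


namespace OPT

open SimpleGraph

variable {V : Type*}

/-- `p` is a path of `G` inside `L`, as a list of vertices. -/
def PathIn (G : SimpleGraph V) (L p : List V) : Prop :=
  p.IsChain G.Adj ∧ p.Nodup ∧ ∀ x ∈ p, x ∈ L

/-- The list order is a one-page book embedding. -/
def NC (G : SimpleGraph V) (L : List V) : Prop :=
  ∀ a c b d, [a, c, b, d].Sublist L → G.Adj a b → ¬ G.Adj c d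

/-- The vertices of `L` induce a connected graph. -/
def Conn (G : SimpleGraph V) (L : List V) : Prop :=
  ∀ r ∈ L, ∀ T : Set V, r ∈ T → (∀ x ∈ T, x ∈ L → ∀ y ∈ L, G.Adj x y → y ∈ T) → ∀ y ∈ L, y ∈ T

/-- Edges inside `L`. -/
def ES (G : SimpleGraph V) (L : List V) : Set (Sym2 V) :=
  {e | e ∈ G.edgeSet ∧ ∀ v ∈ e, v ∈ L}

theorem NC.sublist {G : SimpleGraph V} {L M : List V} (h : NC G L) (hs : M.Sublist L) : NC G M :=
  fun a c b d hh => h a c b d (hh.trans hs)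

theorem NC.rot {G : SimpleGraph V} {A B : List V} (h : NC G (A ++ B)) : NC G (B ++ A) := by
  intro a c b d hs h1 h2
  rw [List.sublist_append_iff] at hs
  obtain ⟨l1, l2, he, hB, hA⟩ := hs
  have key : (l2 ++ l1).Sublist (A ++ B) := hA.append hB
  rcases l1 with _ | ⟨x1, _ | ⟨x2, _ | ⟨x3, _ | ⟨x4, l1⟩⟩⟩⟩
  · simp only [List.nil_append] at he
    subst he
    exact h _ _ _ _ (by simpa using key) h1 h2
  · simp at he
    obtain ⟨rfl, rfl⟩ := he
    exact h _ _ _ _ (by simpa using key) h2 h1.symm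
  · simp at he
    obtain ⟨rfl, rfl, rfl⟩ := he
    exact h _ _ _ _ (by simpa using key) h1.symm h2.symm
  · simp at he
    obtain ⟨rfl, rfl, rfl, rfl⟩ := he
    exact h _ _ _ _ (by simpa using key) h2.symm h1
  · simp at he
    obtain ⟨rfl, rfl, rfl, rfl, rfl, rfl⟩ := he
    exact h _ _ _ _ (by simpa using key) h1 h2

theorem edge_split [Finite V] {G : SimpleGraph V} {L A B : List V}
    (h : ∀ x ∈ L, ∀ y ∈ L, G.Adj x y → (x ∈ A ∧ y ∈ A) ∨ (x ∈ B ∧ y ∈ B)) :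
    (ES G L).ncard ≤ (ES G A).ncard + (ES G B).ncard := by
  refine le_trans (Set.ncard_le_ncard ?_ (Set.toFinite _)) (Set.ncard_union_le _ _)
  intro e
  induction e with
  | _ x y =>
    simp only [ES, Set.mem_ofPred_eq, Set.mem_union, mem_edgeSet, Sym2.mem_iff, forall_eq_or_imp,
      forall_eq]
    rintro ⟨h1, h2, h3⟩
    have := h x h2 y h3 h1
    tauto

theorem edge_split' [Finite V] {G : SimpleGraph V} {L A B : List V} (u w : V)
    (h : ∀ x ∈ L, ∀ y ∈ L, G.Adj x y → (x ∈ A ∧ y ∈ A) ∨ (x ∈ B ∧ y ∈ B) ∨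
      (x = u ∧ y = w) ∨ (x = w ∧ y = u)) :
    (ES G L).ncard ≤ (ES G A).ncard + (ES G B).ncard + 1 := by
  have : (ES G L).ncard ≤ ((ES G A ∪ ES G B) ∪ {s(u, w)}).ncard := by
    refine Set.ncard_le_ncard ?_ (Set.toFinite _)
    intro e
    induction e with
    | _ x y =>
      simp only [ES, Set.mem_ofPred_eq, Set.mem_union, mem_edgeSet, Sym2.mem_iff, forall_eq_or_imp,
        forall_eq, Set.mem_singleton_iff, Sym2.eq_iff]
      rintro ⟨h1, h2, h3⟩
      have := h x h2 y h3 h1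
      tauto
  have h2 := Set.ncard_union_le (ES G A ∪ ES G B) {s(u, w)}
  have h3 := Set.ncard_union_le (ES G A) (ES G B)
  rw [Set.ncard_singleton] at h2
  omega

theorem ES_nil {G : SimpleGraph V} : (ES G []).ncard = 0 := by
  have : ES G [] = ∅ := by
    ext e
    induction e with
    | _ x y =>
      simp only [ES, Set.mem_ofPred_eq, Set.mem_empty_iff_false, iff_false]
      rintro ⟨-, h⟩
      exact List.not_mem_nil (h x (Sym2.mem_mk_left x y))
  rw [this, Set.ncard_empty]

theorem ES_single {G : SimpleGraph V} (v : V) : (ES G [v]).ncard = 0 := by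
  have : ES G [v] = ∅ := by
    ext e
    induction e with
    | _ x y =>
      simp only [ES, Set.mem_ofPred_eq, mem_edgeSet, Sym2.mem_iff, forall_eq_or_imp, forall_eq,
        List.mem_singleton, Set.mem_empty_iff_false, iff_false]
      rintro ⟨h, rfl, rfl⟩
      exact h.ne rfl
  rw [this, Set.ncard_empty]

theorem exists_last (p : V → Prop) : ∀ M : List V, (∃ x ∈ M, p x) →
    ∃ M1 c M2, M = M1 ++ c :: M2 ∧ p c ∧ ∀ y ∈ M2, ¬ p y := by
  intro M
  induction M with
  | nil => simp
  | cons a M ih =>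
    intro h
    by_cases hM : ∃ x ∈ M, p x
    · obtain ⟨M1, c, M2, rfl, h1, h2⟩ := ih hM
      exact ⟨a :: M1, c, M2, rfl, h1, h2⟩
    · push Not at hM
      refine ⟨[], a, M, rfl, ?_, hM⟩
      obtain ⟨x, hx, hp⟩ := h
      rcases List.mem_cons.1 hx with rfl | hx
      · exact hp
      · exact absurd hp (hM x hx)

theorem sub4 {v x c y : V} {M1 M2 : List V} (hx : x ∈ M1) (hy : y ∈ M2) :
    [v, x, c, y].Sublist (v :: (M1 ++ c :: M2)) := by
  refine List.Sublist.cons_cons _ ?_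
  have : ([x] ++ [c, y]).Sublist (M1 ++ c :: M2) :=
    (List.singleton_sublist.2 hx).append ((List.singleton_sublist.2 hy).cons_cons c)
  simpa using this

theorem edge_bound [Finite V] {G : SimpleGraph V} : ∀ (n : ℕ) (L : List V), L.length = n →
    2 ≤ n → NC G L → (ES G L).ncard + 3 ≤ 2 * n := by
  intro n
  induction n using Nat.strong_induction_on with
  | _ n ih =>
  intro L hL hn hNC
  obtain ⟨v, M, rfl⟩ : ∃ v M, L = v :: M := by
    cases L with
    | nil => simp at hL; omega
    | cons v M => exact ⟨v, M, rfl⟩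
  obtain ⟨N, w, rfl⟩ : ∃ N w, M = N ++ [w] := by
    rcases List.eq_nil_or_concat M with rfl | ⟨N, w, h⟩
    · simp at hL; omega
    · exact ⟨N, w, by simpa using h⟩
  by_cases hc : ∃ x ∈ N, G.Adj v x
  · obtain ⟨M1, c, M2, rfl, h1, h2⟩ := exists_last _ N hc
    simp at hL
    have hA := ih (M1.length + 2) (by omega) (v :: (M1 ++ [c])) (by simp) (by omega)
      (hNC.sublist (by simp))
    have hB := ih (M2.length + 2) (by omega) (c :: (M2 ++ [w])) (by simp) (by omega)
      (hNC.sublist (by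
        rw [List.append_assoc]
        exact (List.sublist_append_right M1 _).trans (List.sublist_cons_self _ _)))
    have key : ∀ x ∈ M1, ∀ y ∈ M2 ++ [w], ¬ G.Adj x y := by
      intro x hx y hy
      refine hNC v x c y ?_ h1
      rw [List.append_assoc]
      exact sub4 hx hy
    have := edge_split' (G := G) (L := v :: (M1 ++ c :: M2 ++ [w])) (A := v :: (M1 ++ [c]))
      (B := c :: (M2 ++ [w])) v w (by
        intro x hx y hy hxy
        have hyx := hxy.symm
        have k1 := key x
        have k2 := key y
        have k3 := h2 x
        have k4 := h2 y
        simp only [List.mem_cons, List.mem_append, List.mem_nil_iff, or_false] at *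
        grind)
    omega
  · push Not at hc
    have hB : (ES G (N ++ [w])).ncard + (ES G ([] : List V)).ncard + 1 + 3 ≤ 2 * n := by
      rw [ES_nil]
      rcases N with _ | ⟨u, N⟩
      · simp [ES_single]; omega
      · simp at hL
        have := ih (N.length + 2) (by omega) (u :: N ++ [w]) (by simp) (by omega)
          (hNC.sublist (by simp))
        omega
    have := edge_split' (G := G) (L := v :: (N ++ [w])) (A := N ++ [w])
      (B := []) v w (by
        intro x hx y hy hxy
        have hyx := hxy.symm
        have := hxy.ne
        have k3 := hc x
        have k4 := hc y
        simp only [List.mem_cons, List.mem_append, List.mem_nil_iff, or_false] at *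
        grind)
    omega

theorem chain_of (R : V → V → Prop) : ∀ L : List V,
    (∀ P x y Q, L = P ++ x :: y :: Q → R x y) → L.IsChain R := by
  intro L
  induction L with
  | nil => simp
  | cons a L ih =>
    intro h
    cases L with
    | nil => simp
    | cons b L =>
      rw [List.isChain_cons_cons]
      refine ⟨h [] a b L rfl, ih ?_⟩
      intro P x y Q hh
      exact h (a :: P) x y Q (by rw [hh]; rfl)

/-- connecting paths -/
theorem Conn.path {G : SimpleGraph V} {L : List V} (h : Conn G L) {u v : V} (hu : u ∈ L)
    (hv : v ∈ L) (hne : u ≠ v) : ∃ p, PathIn G L (u :: (p ++ [v])) := by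
  have := h u hu {y | y = u ∨ ∃ p, PathIn G L (u :: (p ++ [y]))} (Or.inl rfl) (by
    intro x hx hxL y hy hxy
    by_cases hyu : y = u
    · exact Or.inl hyu
    right
    rcases hx with rfl | ⟨p, hp⟩
    · refine ⟨[], ?_, ?_, ?_⟩
      · simpa using hxy
      · simpa using fun h => hyu h.symm
      · simp [hxL, hy]
    by_cases hyp : y ∈ p ++ [x]
    · obtain ⟨s, t, hst⟩ := List.append_of_mem hyp
      rw [hst] at hp
      have hpre : (u :: (s ++ [y])) <+: (u :: (s ++ y :: t)) := by
        refine ⟨t, by simp⟩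
      exact ⟨s, List.IsChain.left_of_append (l₂ := t) (by simpa using hp.1), hp.2.1.sublist hpre.sublist, fun z hz => hp.2.2 z (hpre.subset hz)⟩
    · refine ⟨p ++ [x], ?_, ?_, ?_⟩
      · have := hp.1
        rw [← List.cons_append, List.isChain_append]
        refine ⟨this, by simp, ?_⟩
        intro a ha b hb
        simp only [List.head?_cons, Option.mem_def, Option.some.injEq] at hb
        subst hb
        rw [Option.mem_def, ← List.cons_append, List.getLast?_append] at ha
        simp at ha
        exact ha ▸ hxy
      · have := hp.2.1
        rw [← List.cons_append, List.nodup_append]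
        refine ⟨this, by simp, ?_⟩
        intro a ha b hb hab
        simp only [List.mem_singleton] at hb
        subst hb; subst hab
        rcases List.mem_cons.1 ha with h | h
        · exact hyu h
        · exact hyp h
      · intro z hz
        rw [← List.cons_append, List.mem_append] at hz
        rcases hz with hz | hz
        · exact hp.2.2 z hz
        · simp at hz; exact hz ▸ hy) v hv
  rcases this with h | h
  · exact absurd h.symm hne
  · exact h

theorem PathIn.mono {G : SimpleGraph V} {A L p : List V} (h : PathIn G A p)
    (hs : ∀ x ∈ A, x ∈ L) : PathIn G L p :=
  ⟨h.1, h.2.1, fun x hx => hs x (h.2.2 x hx)⟩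

/-- `L` is the union of `A` and `B` glued at the vertex `c`. -/
structure Split (G : SimpleGraph V) (A B L : List V) (c : V) : Prop where
  mem : ∀ x, x ∈ L ↔ x ∈ A ∨ x ∈ B
  cA : c ∈ A
  cB : c ∈ B
  disj : ∀ z ∈ A, z ∈ B → z = c
  cross : ∀ x ∈ A, ∀ y ∈ B, G.Adj x y → x = c ∨ y = c

theorem Split.symm {G : SimpleGraph V} {A B L : List V} {c : V} (h : Split G A B L c) :
    Split G B A L c :=
  ⟨fun x => by rw [h.mem x, or_comm], h.cB, h.cA, fun z h1 h2 => h.disj z h2 h1,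
    fun x hx y hy hxy => (h.cross y hy x hx hxy.symm).symm⟩

theorem Split.conn {G : SimpleGraph V} {A B L : List V} {c : V} (h : Split G A B L c)
    (hL : Conn G L) : Conn G A := by
  intro r hr T hrT hcl
  by_cases hcT : c ∈ T
  · have := hL r ((h.mem r).2 (Or.inl hr)) (T ∪ {z | z ∈ B}) (Or.inl hrT) (by
      intro x hx hxL y hyL hxy
      by_cases hyB : y ∈ B
      · exact Or.inr hyB
      left
      have hyA : y ∈ A := ((h.mem y).1 hyL).resolve_right hyB
      by_cases hxA : x ∈ A
      · rcases hx with hx | hx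
        · exact hcl x hx hxA y hyA hxy
        · have := h.disj x hxA hx
          subst this
          exact hcl x hcT hxA y hyA hxy
      · have hxB : x ∈ B := ((h.mem x).1 hxL).resolve_left hxA
        rcases h.cross y hyA x hxB hxy.symm with rfl | rfl
        · exact hcT
        · exact absurd h.cA hxA)
    intro y hy
    rcases this y ((h.mem y).2 (Or.inl hy)) with h1 | h1
    · exact h1
    · rw [h.disj y hy h1]; exact hcT
  · have := hL r ((h.mem r).2 (Or.inl hr)) (T ∩ {z | z ∈ A}) ⟨hrT, hr⟩ (by
      rintro x ⟨hxT, hxA⟩ hxL y hyL hxy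
      have hyA : y ∈ A := by
        rcases (h.mem y).1 hyL with hy | hy
        · exact hy
        · rcases h.cross x hxA y hy hxy with rfl | rfl
          · exact absurd hxT hcT
          · exact h.cA
      exact ⟨hcl x hxT hxA y hyA hxy, hyA⟩)
    exact absurd (this c ((h.mem c).2 (Or.inl h.cA))).1 hcT

theorem Split.glue {G : SimpleGraph V} {A B L : List V} {c : V} (h : Split G A B L c)
    {p q : List V} (hp : PathIn G A (p ++ [c])) (hq : PathIn G B (c :: q)) :
    PathIn G L (p ++ c :: q) := by
  refine ⟨List.isChain_split.2 ⟨hp.1, hq.1⟩, ?_, ?_⟩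
  · have h1 := hp.2.1
    have h2 := hq.2.1
    rw [List.nodup_append] at h1 ⊢
    refine ⟨h1.1, h2, ?_⟩
    intro a ha b hb hab
    subst hab
    have := h.disj a (hp.2.2 a (by simp [ha])) (hq.2.2 a hb)
    exact h1.2.2 a ha c (by simp) this
  · intro x hx
    rw [h.mem]
    rcases List.mem_append.1 hx with hx | hx
    · exact Or.inl (hp.2.2 x (by simp [hx]))
    · exact Or.inr (hq.2.2 x hx)

theorem PathIn.rev {G : SimpleGraph V} {L p : List V} (h : PathIn G L p) :
    PathIn G L p.reverse := by
  refine ⟨?_, List.nodup_reverse.2 h.2.1, fun x hx => h.2.2 x (List.mem_reverse.1 hx)⟩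
  rw [List.isChain_reverse]
  exact h.1.imp fun a b hab => hab.symm

theorem Split.reach {G : SimpleGraph V} {A B L : List V} {c u : V} {x : ℕ} (h : Split G A B L c)
    (hA : Conn G A) (hu : u ∈ A) (hq : ∃ q, PathIn G B (c :: q) ∧ x ≤ q.length) :
    ∃ q, PathIn G L (u :: q) ∧ x ≤ q.length := by
  obtain ⟨q, hq, hx⟩ := hq
  by_cases huc : u = c
  · subst huc
    exact ⟨q, hq.mono fun z hz => (h.mem z).2 (Or.inr hz), hx⟩
  · obtain ⟨p, hp⟩ := hA.path hu h.cA huc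
    have := h.glue (p := u :: p) (by simpa using hp) hq
    exact ⟨p ++ c :: q, by simpa using this, by simp; omega⟩

theorem Split.join {G : SimpleGraph V} {A B L : List V} {c : V} {x y : ℕ} (h : Split G A B L c)
    (hp : ∃ q, PathIn G A (c :: q) ∧ x ≤ q.length)
    (hq : ∃ q, PathIn G B (c :: q) ∧ y ≤ q.length) :
    ∃ p, PathIn G L p ∧ x + y + 1 ≤ p.length := by
  obtain ⟨p, hp, hx⟩ := hp
  obtain ⟨q, hq, hy⟩ := hq
  refine ⟨p.reverse ++ c :: q, h.glue ?_ hq, by simp; omega⟩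
  simpa using hp.rev

/-- Block sizes (minus one). -/
def Blocks (G : SimpleGraph V) (L : List V) : Prop :=
  ∃ l : List ℕ, l.sum + 1 = L.length ∧ (ES G L).ncard + l.length ≤ 2 * l.sum ∧
    (∀ u ∈ L, ∀ x ∈ l, ∃ q, PathIn G L (u :: q) ∧ x ≤ q.length) ∧
    l.Pairwise (fun x y => ∃ p, PathIn G L p ∧ x + y + 1 ≤ p.length)

theorem Split.blocks [Finite V] {G : SimpleGraph V} {A B L : List V} {c : V}
    (h : Split G A B L c) (hL : Conn G L) (hlen : A.length + B.length = L.length + 1)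
    (hA : Blocks G A) (hB : Blocks G B) : Blocks G L := by
  have cA := h.conn hL
  have cB := h.symm.conn hL
  obtain ⟨l1, a1, a2, a3, a4⟩ := hA
  obtain ⟨l2, b1, b2, b3, b4⟩ := hB
  have mA : ∀ z ∈ A, z ∈ L := fun z hz => (h.mem z).2 (Or.inl hz)
  have mB : ∀ z ∈ B, z ∈ L := fun z hz => (h.mem z).2 (Or.inr hz)
  refine ⟨l1 ++ l2, ?_, ?_, ?_, ?_⟩
  · simp; omega
  · have := edge_split (G := G) (L := L) (A := A) (B := B) (by
      intro x hx y hy hxy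
      have c1 := h.cross x
      have c2 := h.cross y
      have := hxy.symm
      have := h.cA
      have := h.cB
      rcases (h.mem x).1 hx with hx | hx <;> rcases (h.mem y).1 hy with hy | hy <;> grind)
    simp; omega
  · intro u hu x hx
    rcases (h.mem u).1 hu with hu | hu <;> rcases List.mem_append.1 hx with hx | hx
    · obtain ⟨q, hq, hh⟩ := a3 u hu x hx
      exact ⟨q, hq.mono mA, hh⟩
    · exact h.reach cA hu (b3 c h.cB x hx)
    · exact h.symm.reach cB hu (a3 c h.cA x hx)
    · obtain ⟨q, hq, hh⟩ := b3 u hu x hx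
      exact ⟨q, hq.mono mB, hh⟩
  · rw [List.pairwise_append]
    refine ⟨a4.imp ?_, b4.imp ?_, ?_⟩
    · rintro x y ⟨p, hp, hh⟩
      exact ⟨p, hp.mono mA, hh⟩
    · rintro x y ⟨p, hp, hh⟩
      exact ⟨p, hp.mono mB, hh⟩
    · intro x hx y hy
      exact h.join (a3 c h.cA x hx) (b3 c h.cB y hy)

theorem Blocks.perm [Finite V] {G : SimpleGraph V} {L M : List V} (h : Blocks G L)
    (hp : L.Perm M) : Blocks G M := by
  have mA : ∀ z ∈ L, z ∈ M := fun z hz => hp.mem_iff.1 hz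
  obtain ⟨l, a1, a2, a3, a4⟩ := h
  have e : ES G M = ES G L := by
    ext e
    simp only [ES, Set.mem_ofPred_eq, hp.mem_iff]
  refine ⟨l, by rw [← hp.length_eq, a1], by rw [e]; exact a2, ?_, a4.imp ?_⟩
  · intro u hu x hx
    obtain ⟨q, hq, hh⟩ := a3 u (hp.mem_iff.2 hu) x hx
    exact ⟨q, hq.mono mA, hh⟩
  · rintro x y ⟨p, hp, hh⟩
    exact ⟨p, hp.mono mA, hh⟩

theorem Conn.perm {G : SimpleGraph V} {L M : List V} (h : Conn G L)
    (hp : L.Perm M) : Conn G M := by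
  intro r hr T hT hcl y hy
  refine h r (hp.mem_iff.2 hr) T hT ?_ y (hp.mem_iff.2 hy)
  intro x hx hxL y hy
  exact hcl x hx (hp.mem_iff.1 hxL) y (hp.mem_iff.1 hy)

theorem NC.isRotated {G : SimpleGraph V} {L M : List V} (h : NC G L) (hr : L ~r M) : NC G M := by
  obtain ⟨n, hn, rfl⟩ := List.isRotated_iff_mod.1 hr
  rw [List.rotate_eq_drop_append_take hn]
  apply NC.rot
  rwa [List.take_append_drop]

theorem exists_blocks [Finite V] {G : SimpleGraph V} : ∀ (n : ℕ) (L : List V), L.length = n →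
    1 ≤ n → L.Nodup → NC G L → Conn G L → Blocks G L := by
  intro n
  induction n using Nat.strong_induction_on with
  | _ n ih =>
  intro L hL hn hnd hNC hC
  by_cases hn1 : n = 1
  · subst hn1
    obtain ⟨v, rfl⟩ := List.length_eq_one_iff.1 hL
    exact ⟨[], by simp, by simp [ES_single], by simp, by simp⟩
  by_cases H : ∀ v M w, L ~r (v :: (M ++ [w])) → G.Adj v w
  · refine ⟨[n - 1], by simp; omega, ?_, ?_, by simp⟩
    · have := edge_bound n L hL (by omega) hNC
      simp; omega
    · intro u hu x hx
      simp only [List.mem_singleton] at hx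
      subst hx
      obtain ⟨A, B, rfl⟩ := List.append_of_mem hu
      have hrot : (A ++ u :: B) ~r (u :: (B ++ A)) := List.isRotated_append
      refine ⟨B ++ A, ⟨?_, hrot.nodup_iff.1 hnd, fun x hx => hrot.mem_iff.2 hx⟩, ?_⟩
      · apply chain_of
        intro P x y Q h
        rw [h] at hrot
        refine (H y (Q ++ P) x (hrot.trans ?_)).symm
        have : (P ++ [x]) ++ y :: Q ~r (y :: Q) ++ (P ++ [x]) := List.isRotated_append
        simpa using this
      · simp at hL ⊢; omega
  · push Not at H
    obtain ⟨v, M, w, hrot, hvw⟩ := H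
    have hnd' := hrot.nodup_iff.1 hnd
    have hNC' := hNC.isRotated hrot
    have hC' := hC.perm hrot.perm
    have hL' := hrot.perm.length_eq
    rw [hL] at hL'
    refine Blocks.perm ?_ hrot.perm.symm
    clear hrot hL hnd hNC hC L
    have hex : ∃ x ∈ M ++ [w], G.Adj v x := by
      by_contra hcon
      push Not at hcon
      have := hC' v (by simp) {v} rfl (by
        rintro x rfl - y hy hxy
        rcases List.mem_cons.1 hy with rfl | hy
        · rfl
        · exact absurd hxy (hcon y hy)) w (by simp)
      simp only [Set.mem_singleton_iff] at this
      subst this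
      simp at hnd'
    obtain ⟨M1, c, M2, hM, h1, h2⟩ := exists_last _ _ hex
    have hM2 : M2 ≠ [] := by
      rintro rfl
      have := List.append_inj_right' hM (by simp)
      simp at this
      subst this
      exact hvw h1
    rw [hM] at hnd' hNC' hC' hL' ⊢
    have hpos : 0 < M2.length := List.length_pos_iff.2 hM2
    have key : ∀ x ∈ M1, ∀ y ∈ M2, ¬ G.Adj x y := by
      intro x hx y hy
      exact hNC' v x c y (sub4 hx hy) h1
    have hS : Split G (v :: (M1 ++ [c])) (c :: M2) (v :: (M1 ++ c :: M2)) c := by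
      refine ⟨?_, by simp, by simp, ?_, ?_⟩
      · intro x; simp; tauto
      · intro z hz hz'
        simp [List.nodup_append] at hnd' hz hz'
        grind
      · intro x hx y hy hxy
        simp at hx hy
        grind
    simp at hL'
    have s1 : (v :: (M1 ++ [c])).Sublist (v :: (M1 ++ c :: M2)) := by simp
    have s2 : (c :: M2).Sublist (v :: (M1 ++ c :: M2)) :=
      (List.sublist_append_right M1 _).trans (List.sublist_cons_self _ _)
    refine hS.blocks hC' (by simp; omega) ?_ ?_
    · exact ih (M1.length + 2) (by omega) _ (by simp) (by omega) (hnd'.sublist s1)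
        (hNC'.sublist s1) (hS.conn hC')
    · exact ih (M2.length + 1) (by omega) _ (by simp) (by omega) (hnd'.sublist s2)
        (hNC'.sublist s2) (hS.symm.conn hC')

theorem sum_bound (s t : ℕ) (e : ℕ) (he : e ≤ 1) : ∀ l : List ℕ, 2 ≤ l.length → s = 2 * t + e →
    l.Pairwise (fun x y => x + y ≤ s) → l.sum ≤ l.length * t + e := by
  intro l hl hs hp
  subst hs
  have small : ∀ (r : ℕ) (l : List ℕ), (∀ x ∈ l, x ≤ r) → l.sum ≤ l.length * r := by
    intro r l h
    simpa using List.sum_le_card_nsmul l r h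
  have gen : ∀ l : List ℕ, l.Pairwise (fun x y => x + y ≤ 2 * t + e) →
      (∀ x ∈ l, x ≤ t) ∨ (l.length = 1) ∨ l.sum ≤ l.length * t + e := by
    intro l
    induction l with
    | nil => simp
    | cons a l ih =>
      intro h
      rw [List.pairwise_cons] at h
      by_cases hat : a ≤ t
      · rcases ih h.2 with h' | h' | h'
        · left; simpa [hat] using h'
        · right; right
          obtain ⟨b, rfl⟩ := List.length_eq_one_iff.1 h'
          have := h.1 b (by simp)
          simp; omega
        · right; right
          simp [add_mul]; omega
      · rcases l with _ | ⟨b, l⟩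
        · right; left; rfl
        · right; right
          have hb := h.1 b (by simp)
          have := small t l (by
            intro x hx
            have := h.1 x (by simp [hx])
            omega)
          simp [add_mul]; omega
  rcases gen l hp with h | h | h
  · have := small t l h
    omega
  · omega
  · exact h

/-- The bound for graphs with a large component. -/
def Bd (t e a E : ℕ) : Prop := ∃ m, E + m + 2 ≤ 2 * a ∧ a ≤ m * t + 1 + e

theorem conn_bd [Finite V] {G : SimpleGraph V} {L : List V} {k t e : ℕ} (he : e ≤ 1)
    (hk : k = 2 * t + e + 2) (hL : k ≤ L.length)
    (hnd : L.Nodup) (hNC : NC G L) (hC : Conn G L) (hP : ∀ p, PathIn G L p → p.length < k) :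
    Bd t e L.length (ES G L).ncard := by
  obtain ⟨l, a1, a2, a3, a4⟩ := exists_blocks L.length L rfl (by omega) hnd hNC hC
  have hl : 2 ≤ l.length := by
    rcases l with _ | ⟨x, _ | ⟨y, l⟩⟩
    · simp at a1; omega
    · obtain ⟨u, hu⟩ := List.exists_mem_of_length_pos (l := L) (by omega)
      obtain ⟨q, hq, hx⟩ := a3 u hu x (by simp)
      have := hP _ hq
      simp at this a1
      omega
    · simp
  have := sum_bound (k - 2) t e he l hl (by omega) (a4.imp (by
    rintro x y ⟨p, hp, hh⟩
    have := hP p hp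
    omega))
  exact ⟨l.length, by omega, by omega⟩

theorem not_conn [Finite V] {G : SimpleGraph V} {L : List V} (h : ¬ Conn G L) :
    ∃ A B : List V, A.Sublist L ∧ B.Sublist L ∧ A.length + B.length = L.length ∧
      A ≠ [] ∧ B ≠ [] ∧ (ES G L).ncard ≤ (ES G A).ncard + (ES G B).ncard := by
  classical
  unfold Conn at h
  push Not at h
  obtain ⟨r, hr, T, hrT, hcl, y, hy, hyT⟩ := h
  refine ⟨L.filter (· ∈ T), L.filter (fun x => ! decide (x ∈ T)), List.filter_sublist,
    List.filter_sublist, ?_, ?_, ?_, ?_⟩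
  · exact (List.length_eq_length_filter_add _).symm
  · exact List.ne_nil_of_mem (a := r) (by simp [hr, hrT])
  · exact List.ne_nil_of_mem (a := y) (by simp [hy, hyT])
  · apply edge_split
    intro x hx z hz hxz
    have h1 := hcl x
    have h2 := hcl z
    have := hxz.symm
    simp
    grind

theorem add_bd [Finite V] {G : SimpleGraph V} {k t e : ℕ} (he : e + 1 ≤ t) (he1 : e ≤ 1)
    (hk : k = 2 * t + e + 2) : ∀ (n : ℕ) (L : List V), L.length = n →
    L.Nodup → NC G L → (∀ p, PathIn G L p → p.length < k) →
    ∀ a E, Bd t e a E → Bd t e (a + n) (E + (ES G L).ncard) := by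
  intro n
  induction n using Nat.strong_induction_on with
  | _ n ih =>
  intro L hL hnd hNC hP a E hbd
  by_cases h0 : n = 0
  · subst h0
    have := List.length_eq_zero_iff.1 hL
    subst this
    simpa [ES_nil] using hbd
  by_cases hC : Conn G L
  · obtain ⟨m, h1, h2⟩ := hbd
    by_cases hkn : k ≤ n
    · obtain ⟨m', h3, h4⟩ := conn_bd he1 hk (hL ▸ hkn) hnd hNC hC hP
      exact ⟨m + m' + 2, by omega, by simp only [add_mul]; omega⟩
    · by_cases hn1 : n = 1
      · subst hn1
        obtain ⟨v, rfl⟩ := List.length_eq_one_iff.1 hL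
        rw [ES_single]
        exact ⟨m + 1, by omega, by simp only [add_mul]; omega⟩
      · have := edge_bound n L hL (by omega) hNC
        exact ⟨m + 3, by omega, by simp only [add_mul]; omega⟩
  · obtain ⟨A, B, sA, sB, hlen, hA, hB, hE⟩ := not_conn hC
    have hA := List.length_pos_iff.2 hA
    have hB := List.length_pos_iff.2 hB
    have i1 := ih A.length (by omega) A rfl (hnd.sublist sA) (hNC.sublist sA)
      (fun p hp => hP p (hp.mono fun x hx => sA.subset hx)) a E hbd
    obtain ⟨m, i2, i3⟩ := ih B.length (by omega) B rfl (hnd.sublist sB) (hNC.sublist sB)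
      (fun p hp => hP p (hp.mono fun x hx => sB.subset hx)) _ _ i1
    exact ⟨m, by omega, by omega⟩

theorem five_bd [Finite V] {G : SimpleGraph V} : ∀ (n : ℕ) (L : List V), L.length = n →
    L.Nodup → NC G L → (∀ p, PathIn G L p → p.length < 5) →
    (ES G L).ncard ≤ 5 * (n / 4) + (2 * (n % 4) - 3) := by
  intro n
  induction n using Nat.strong_induction_on with
  | _ n ih =>
  intro L hL hnd hNC hP
  by_cases h0 : n = 0
  · subst h0
    have := List.length_eq_zero_iff.1 hL
    subst this
    simp [ES_nil]
  by_cases hC : Conn G L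
  · by_cases hkn : 5 ≤ n
    · obtain ⟨m', h3, h4⟩ := conn_bd (t := 1) (e := 1) (k := 5) (by omega) (by omega)
        (hL ▸ hkn) hnd hNC hC hP
      omega
    · by_cases hn1 : n = 1
      · subst hn1
        obtain ⟨v, rfl⟩ := List.length_eq_one_iff.1 hL
        rw [ES_single]
      · have := edge_bound n L hL (by omega) hNC
        omega
  · obtain ⟨A, B, sA, sB, hlen, hA, hB, hE⟩ := not_conn hC
    have hA := List.length_pos_iff.2 hA
    have hB := List.length_pos_iff.2 hB
    have i1 := ih A.length (by omega) A rfl (hnd.sublist sA) (hNC.sublist sA)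
      (fun p hp => hP p (hp.mono fun x hx => sA.subset hx))
    have i2 := ih B.length (by omega) B rfl (hnd.sublist sB) (hNC.sublist sB)
      (fun p hp => hP p (hp.mono fun x hx => sB.subset hx))
    omega

theorem exists_list {n : ℕ} {G : SimpleGraph (Fin n)} (h : IsOuterplanar G) :
    ∃ L : List (Fin n), L.Nodup ∧ (∀ x, x ∈ L) ∧ NC G L := by
  obtain ⟨f, hf, hc⟩ := h
  let r : Fin n → Fin n → Prop := fun a b => f a ≤ f b
  have : DecidableRel r := fun a b => inferInstanceAs (Decidable (f a ≤ f b))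
  have : Std.Total r := ⟨fun a b => le_total (f a) (f b)⟩
  have : IsTrans (Fin n) r := ⟨fun a b c h1 h2 => le_trans (α := ℤ) h1 h2⟩
  have hp := List.perm_insertionSort r (List.finRange n)
  have hs := List.pairwise_insertionSort r (List.finRange n)
  have hnd : (List.insertionSort r (List.finRange n)).Nodup :=
    hp.nodup_iff.2 (List.nodup_finRange n)
  refine ⟨_, hnd, fun x => hp.mem_iff.2 (List.mem_finRange x), ?_⟩
  intro a c b d hsub hab hcd
  have h1 := hs.sublist hsub
  have h2 := hnd.sublist hsub
  simp [r] at h1 h2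
  have n1 : f a ≠ f c := fun h => h2.1.1 (hf h)
  have n2 : f c ≠ f b := fun h => h2.2.1.1 (hf h)
  have n3 : f b ≠ f d := fun h => h2.2.2 (hf h)
  exact hc a b c d hab hcd ⟨by omega, by omega, by omega⟩

theorem path_short {G : SimpleGraph V} {k : ℕ} (h : ¬ ContainsCopy (pathGraph k) G)
    {L p : List V} (hp : PathIn G L p) : p.length < k := by
  by_contra hcon
  push Not at hcon
  apply h
  have hch := List.isChain_iff_getElem.1 hp.1
  refine ⟨⟨fun i => p[i.val]'(by omega), ?_⟩, ?_⟩
  · intro i j hij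
    rw [pathGraph_adj] at hij
    rcases hij with hij | hij
    · have := hch i.val (by omega)
      simpa [hij] using this
    · have := hch j.val (by omega)
      simpa [hij] using this.symm
  · intro i j hij
    have := (hp.2.1.getElem_inj_iff).1 hij
    exact Fin.ext this

theorem ES_all {G : SimpleGraph V} {L : List V} (h : ∀ x, x ∈ L) : ES G L = G.edgeSet := by
  ext e
  simp [ES, h]

theorem big_bd {n k t e : ℕ} {G : SimpleGraph (Fin n)} (h : IsOuterplanar G)
    (hP : ¬ ContainsCopy (pathGraph k) G) (he : e + 1 ≤ t) (he1 : e ≤ 1)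
    (hk : k = 2 * t + e + 2) (c : G.ConnectedComponent) (hc : k ≤ c.supp.ncard) :
    Bd t e n G.edgeSet.ncard := by
  classical
  obtain ⟨L, hnd, hall, hNC⟩ := exists_list h
  have hLn : L.length = n := by
    have : L.toFinset = Finset.univ := by ext x; simp [hall]
    rw [← List.toFinset_card_of_nodup hnd, this]; simp
  set A := L.filter (fun x => decide (x ∈ c.supp)) with hA
  set B := L.filter (fun x => ! decide (x ∈ c.supp)) with hB
  have sA : A.Sublist L := List.filter_sublist
  have sB : B.Sublist L := List.filter_sublist
  have mA : ∀ x, x ∈ A ↔ x ∈ c.supp := by intro x; simp [hA, hall]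
  have mB : ∀ x, x ∈ B ↔ x ∉ c.supp := by intro x; simp [hB, hall]
  have hlen : A.length + B.length = n := by
    exact (List.length_eq_length_filter_add _).symm.trans hLn
  have hAk : k ≤ A.length := by
    rw [← List.toFinset_card_of_nodup (hnd.sublist sA), ← Set.ncard_coe_finset]
    convert hc using 2
    ext x
    simp [mA]
  have hcA : Conn G A := by
    intro r hr T hrT hcl y hy
    have hry : G.Reachable r y := by
      rw [mA, ConnectedComponent.mem_supp_iff] at hr hy
      exact ConnectedComponent.exact (hr.trans hy.symm)
    obtain ⟨w⟩ := hry
    have : ∀ {a b : Fin n} (w : G.Walk a b), a ∈ A → a ∈ T → b ∈ T := by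
      intro a b w
      induction w with
      | nil => exact fun _ h => h
      | @cons a b d hab w ih =>
        intro ha haT
        have hb : b ∈ A := by
          rw [mA, ConnectedComponent.mem_supp_iff] at ha ⊢
          rw [← ha]
          exact ConnectedComponent.sound hab.symm.reachable
        exact ih hb (hcl a haT ha b hb hab)
    exact this w hr hrT
  have b1 := conn_bd he1 hk hAk (hnd.sublist sA) (hNC.sublist sA) hcA
    (fun p hp => path_short hP hp)
  obtain ⟨m, h1, h2⟩ := add_bd he he1 hk B.length B rfl (hnd.sublist sB) (hNC.sublist sB)
    (fun p hp => path_short hP hp) _ _ b1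
  have hE := edge_split (G := G) (L := L) (A := A) (B := B) (by
    intro x _ y _ hxy
    have : x ∈ c.supp ↔ y ∈ c.supp := by
      rw [ConnectedComponent.mem_supp_iff, ConnectedComponent.mem_supp_iff,
        ConnectedComponent.sound hxy.reachable]
    rw [mA, mA, mB, mB]
    tauto)
  rw [ES_all hall] at hE
  exact ⟨m, by omega, by omega⟩

theorem five_bd' {n : ℕ} {G : SimpleGraph (Fin n)} (h : IsOuterplanar G)
    (hP : ¬ ContainsCopy (pathGraph 5) G) :
    G.edgeSet.ncard ≤ 5 * (n / 4) + (2 * (n % 4) - 3) := by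
  classical
  obtain ⟨L, hnd, hall, hNC⟩ := exists_list h
  have hLn : L.length = n := by
    have : L.toFinset = Finset.univ := by ext x; simp [hall]
    rw [← List.toFinset_card_of_nodup hnd, this]; simp
  have := five_bd n L hLn hnd hNC (fun p hp => path_short hP hp)
  rwa [ES_all hall] at this

/-- Ordered pair (max, min) of an edge. -/
def maxMin {n : ℕ} : Sym2 (Fin n) → (Σ _ : ℕ, ℕ) :=
  Sym2.lift ⟨fun a b => ⟨max a.val b.val, min a.val b.val⟩, fun a b => by
    simp only [max_comm a.val, min_comm a.val]⟩

theorem edge_count {n : ℕ} (H : SimpleGraph (Fin n)) (D : ℕ → Finset ℕ)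
    (h : ∀ i j (hi : i < n) (hj : j < n), i ∈ D j → H.Adj ⟨i, hi⟩ ⟨j, hj⟩)
    (hlt : ∀ i j, i ∈ D j → i < j) :
    ∑ j ∈ Finset.range n, (D j).card ≤ H.edgeSet.ncard := by
  rw [← Finset.card_sigma, ← Set.ncard_coe_finset]
  refine le_trans (Set.ncard_le_ncard ?_ (Set.toFinite _))
    (Set.ncard_image_le (f := maxMin) (Set.toFinite H.edgeSet))
  rintro ⟨j, i⟩ hij
  simp only [Finset.coe_sigma, Set.mem_sigma_iff, Finset.coe_range, Set.mem_Iio,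
    Finset.mem_coe] at hij
  have hl := hlt i j hij.2
  refine ⟨s(⟨i, by omega⟩, ⟨j, hij.1⟩), h _ _ _ _ hij.2, ?_⟩
  simp only [maxMin, Sym2.lift_mk]
  rw [max_eq_right hl.le, min_eq_left hl.le]

/-- The fan-like extremal graph: a center joined to disjoint paths. -/
def fan (n t e : ℕ) : SimpleGraph (Fin n) where
  Adj i j := i ≠ j ∧ (i.val = 0 ∨ j.val = 0 ∨
    ((i.val - 1 - e) / t = (j.val - 1 - e) / t ∧ (i.val + 1 = j.val ∨ j.val + 1 = i.val)))
  symm := ⟨by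
    rintro i j ⟨h1, h2⟩
    refine ⟨h1.symm, ?_⟩
    rcases h2 with h | h | ⟨h, h'⟩
    · exact Or.inr (Or.inl h)
    · exact Or.inl h
    · exact Or.inr (Or.inr ⟨h.symm, h'.symm⟩)⟩
  loopless := ⟨fun i h => h.1 rfl⟩

theorem fan_op (n t e : ℕ) : IsOuterplanar (fan n t e) := by
  refine ⟨fun i => (i.val : ℤ), fun i j h => Fin.ext (by simpa using h), ?_⟩
  rintro a b c d ⟨-, h1⟩ ⟨-, h2⟩ h3
  dsimp only at h3
  omega

theorem fan_conn (n t e : ℕ) (hn : 0 < n) : (fan n t e).Connected := by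
  have : Nonempty (Fin n) := ⟨⟨0, hn⟩⟩
  have key : ∀ i : Fin n, (fan n t e).Reachable ⟨0, hn⟩ i := by
    intro i
    by_cases h : (⟨0, hn⟩ : Fin n) = i
    · rw [h]
    · exact SimpleGraph.Adj.reachable ⟨h, Or.inl rfl⟩
  exact ⟨fun i j => (key i).symm.trans (key j)⟩

theorem fan_edges (n t e : ℕ) (hn : 2 ≤ n) :
    2 * n ≤ (fan n t e).edgeSet.ncard + (n - 2 - e) / t + 3 := by
  classical
  let D : ℕ → Finset ℕ := fun j => if j = 0 then ∅ else if j = 1 then {0} else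
    if (j - 1 - 1 - e) / t = (j - 1 - e) / t then {0, j - 1} else {0}
  have h := edge_count (fan n t e) D (by
    intro i j hi hj hij
    simp only [fan, ne_eq, Fin.mk.injEq]
    simp only [D] at hij
    split_ifs at hij with h1 h2 h3
    · simp at hij
    · simp at hij; omega
    · simp at hij
      rcases hij with rfl | rfl
      · omega
      · exact ⟨by omega, Or.inr (Or.inr ⟨h3, by omega⟩)⟩
    · simp at hij; omega) (by
    intro i j hij
    simp only [D] at hij
    split_ifs at hij with h1 h2 h3
    · simp at hij
    · simp at hij; omega
    · simp at hij; omega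
    · simp at hij; omega)
  have h2 : ∀ n, 2 ≤ n → 2 * n ≤ ∑ j ∈ Finset.range n, (D j).card + (n - 2 - e) / t + 3 := by
    intro n hn
    induction n, hn using Nat.le_induction with
    | base => simp [Finset.sum_range_succ, D]
    | succ n hn ih =>
      rw [Finset.sum_range_succ]
      have hD : (D n).card = if (n - 2 - e) / t = (n + 1 - 2 - e) / t then 2 else 1 := by
        simp only [D]
        rw [if_neg (by omega), if_neg (by omega)]
        have e1 : n - 1 - 1 - e = n - 2 - e := by omega
        have e2 : n - 1 - e = n + 1 - 2 - e := by omega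
        rw [e1, e2]
        split_ifs
        · rw [Finset.card_pair (by omega)]
        · simp
      have hle : (n - 2 - e) / t ≤ (n + 1 - 2 - e) / t := Nat.div_le_div_right (by omega)
      rw [hD]
      split_ifs <;> omega
  have := h2 n hn
  omega

theorem fan_free (n t e k : ℕ) (ht : 1 ≤ t) (hk : k = 2 * t + e + 2) :
    ¬ ContainsCopy (pathGraph k) (fan n t e) := by
  classical
  rintro ⟨φ, hφ⟩
  have hkpos : 0 < k := by omega
  let F : ℕ → ℕ := fun i => if h : i < k then (φ ⟨i, h⟩).val else 0
  have hF : ∀ i (h : i < k), F i = (φ ⟨i, h⟩).val := fun i h => by simp [F, h]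
  have inj : ∀ i j, i < k → j < k → F i = F j → i = j := by
    intro i j hi hj hij
    rw [hF i hi, hF j hj] at hij
    have := hφ (Fin.ext hij)
    simpa using this
  let gr : ℕ → ℕ := fun x => (x - 1 - e) / t
  have step : ∀ i, i + 1 < k → F i ≠ 0 → F (i + 1) ≠ 0 → gr (F i) = gr (F (i + 1)) := by
    intro i hi h1 h2
    have hadj : (pathGraph k).Adj ⟨i, by omega⟩ ⟨i + 1, hi⟩ := by
      rw [pathGraph_adj]; simp
    have := (φ.map_rel hadj).2
    rw [← hF, ← hF] at this
    rcases this with h | h | h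
    · exact absurd h h1
    · exact absurd h h2
    · exact h.1
  have seg : ∀ a b, a ≤ b → b < k → (∀ j, a ≤ j → j ≤ b → F j ≠ 0) → gr (F a) = gr (F b) := by
    intro a b hab
    induction b, hab using Nat.le_induction with
    | base => intros; rfl
    | succ b hab ih =>
      intro hb h
      rw [ih (by omega) (fun j h1 h2 => h j h1 (by omega))]
      exact step b hb (h b hab (by omega)) (h (b + 1) (by omega) le_rfl)
  let blk : ℕ → Finset ℕ := fun g =>
    if g = 0 then Finset.Ico 1 (1 + (t + e)) else
      Finset.Ico (g * t + 1 + e) (g * t + 1 + e + t)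
  have hblk : ∀ x, x ≠ 0 → x ∈ blk (gr x) := by
    intro x hx
    have h1 := Nat.div_add_mod (x - 1 - e) t
    have h2 := Nat.mod_lt (x - 1 - e) (show 0 < t by omega)
    simp only [blk, gr]
    split_ifs with h
    · rw [h] at h1
      simp only [Finset.mem_Ico]
      omega
    · have h3 : t ≤ t * ((x - 1 - e) / t) := Nat.le_mul_of_pos_right t (Nat.pos_of_ne_zero h)
      rw [mul_comm ((x - 1 - e) / t) t]
      simp only [Finset.mem_Ico]
      omega
  have card0 : (blk 0).card = t + e := by simp [blk]
  have card1 : ∀ g, g ≠ 0 → (blk g).card = t := by intro g hg; simp [blk, hg]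
  have cardU : ∀ g g', (blk g ∪ blk g').card ≤ 2 * t + e := by
    intro g g'
    by_cases h : g = g'
    · subst h
      rw [Finset.union_self]
      by_cases h0 : g = 0
      · subst h0; omega
      · rw [card1 g h0]; omega
    · have := Finset.card_union_le (blk g) (blk g')
      by_cases h0 : g = 0
      · subst h0
        have := card1 g' (Ne.symm h)
        omega
      · have := card1 g h0
        by_cases h0' : g' = 0
        · subst h0'; omega
        · have := card1 g' h0'
          omega
  have sub : (Finset.range k).image F ⊆ insert 0 (blk (gr (F 0)) ∪ blk (gr (F (k - 1)))) := by
    intro x hx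
    obtain ⟨i, hi, rfl⟩ := Finset.mem_image.1 hx
    rw [Finset.mem_range] at hi
    rw [Finset.mem_insert, Finset.mem_union]
    by_cases h0 : F i = 0
    · exact Or.inl h0
    right
    by_cases hj : ∀ j, 0 ≤ j → j ≤ i → F j ≠ 0
    · left
      rw [seg 0 i (by omega) hi hj]
      exact hblk _ h0
    · right
      push Not at hj
      obtain ⟨j, -, hji, hj0⟩ := hj
      rw [← seg i (k - 1) (by omega) (by omega) (by
        intro l h1 h2 h3
        have := inj j l (by omega) (by omega) (by rw [hj0, h3])
        have : i = l := by omega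
        subst this
        exact h0 h3)]
      exact hblk _ h0
  have c1 := Finset.card_le_card sub
  rw [Finset.card_image_of_injOn (by
    intro i hi j hj hij
    simp at hi hj
    exact inj i j hi hj hij), Finset.card_range] at c1
  have c2 := Finset.card_insert_le 0 (blk (gr (F 0)) ∪ blk (gr (F (k - 1))))
  have c3 := cardU (gr (F 0)) (gr (F (k - 1)))
  omega

/-- Disjoint copies of `K₄` minus an edge. -/
def dia (n : ℕ) : SimpleGraph (Fin n) where
  Adj i j := i ≠ j ∧ i.val / 4 = j.val / 4 ∧ ¬ (i.val % 4 = 1 ∧ j.val % 4 = 3) ∧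
    ¬ (j.val % 4 = 1 ∧ i.val % 4 = 3)
  symm := ⟨by
    rintro i j ⟨h1, h2, h3, h4⟩
    exact ⟨h1.symm, h2.symm, h4, h3⟩⟩
  loopless := ⟨fun i h => h.1 rfl⟩

theorem dia_op (n : ℕ) : IsOuterplanar (dia n) := by
  refine ⟨fun i => (i.val : ℤ), fun i j h => Fin.ext (by simpa using h), ?_⟩
  rintro a b c d ⟨-, h1⟩ ⟨-, h2⟩ h3
  dsimp only at h3
  omega

theorem dia_edges (n : ℕ) :
    5 * (n / 4) + (2 * (n % 4) - 3) ≤ (dia n).edgeSet.ncard := by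
  classical
  let D : ℕ → Finset ℕ := fun j => if j % 4 = 0 then ∅ else if j % 4 = 1 then {j - 1} else
    if j % 4 = 2 then {j - 1, j - 2} else {j - 1, j - 3}
  have h := edge_count (dia n) D (by
    intro i j hi hj hij
    simp only [dia, ne_eq, Fin.mk.injEq]
    simp only [D] at hij
    split_ifs at hij with h1 h2 h3 <;> simp at hij <;> omega) (by
    intro i j hij
    simp only [D] at hij
    split_ifs at hij with h1 h2 h3 <;> simp at hij <;> omega)
  have h2 : ∀ n, 5 * (n / 4) + (2 * (n % 4) - 3) ≤ ∑ j ∈ Finset.range n, (D j).card := by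
    intro n
    induction n with
    | zero => simp
    | succ n ih =>
      rw [Finset.sum_range_succ]
      have hD : (D n).card = if n % 4 = 0 then 0 else if n % 4 = 1 then 1 else 2 := by
        simp only [D]
        split_ifs
        · simp
        · simp
        · rw [Finset.card_pair (by omega)]
        · rw [Finset.card_pair (by omega)]
      rw [hD]
      split_ifs <;> omega
  exact (h2 n).trans h

theorem card_group {n : ℕ} (g : ℕ) (S : Set (Fin n)) (h : ∀ x ∈ S, x.val / 4 = g) :
    S.ncard ≤ 4 := by
  have h1 : (Fin.val '' S).ncard ≤ ((Finset.Ico (4 * g) (4 * g + 4) : Finset ℕ) : Set ℕ).ncard := by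
    apply Set.ncard_le_ncard _ (Finset.finite_toSet _)
    rintro _ ⟨x, hx, rfl⟩
    have := h x hx
    simp only [Finset.coe_Ico, Set.mem_Ico]
    omega
  rw [Set.ncard_image_of_injective _ Fin.val_injective, Set.ncard_coe_finset] at h1
  simpa using h1

theorem dia_comp (n : ℕ) (c : (dia n).ConnectedComponent) : c.supp.ncard ≤ 4 := by
  induction c using ConnectedComponent.ind with
  | _ v =>
  apply card_group (v.val / 4)
  intro x hx
  rw [ConnectedComponent.mem_supp_iff] at hx
  obtain ⟨w⟩ := ConnectedComponent.exact hx
  induction w with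
  | nil => rfl
  | @cons a b d hab w ih =>
    rw [hab.2.1]
    exact ih (ConnectedComponent.sound w.reachable)

theorem dia_free (n : ℕ) : ¬ ContainsCopy (pathGraph 5) (dia n) := by
  rintro ⟨φ, hφ⟩
  have key : ∀ i (h : i < 5), (φ ⟨i, h⟩).val / 4 = (φ 0).val / 4 := by
    intro i
    induction i with
    | zero => intro h; rfl
    | succ i ih =>
      intro h
      rw [← ih (by omega)]
      have hadj : (pathGraph 5).Adj ⟨i, by omega⟩ ⟨i + 1, h⟩ := by
        rw [pathGraph_adj]; simp
      exact (φ.map_rel hadj).2.1.symm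
  have := card_group ((φ 0).val / 4) (Set.range φ) (by
    rintro _ ⟨i, rfl⟩
    exact key i.val i.isLt)
  rw [← Set.image_univ, Set.ncard_image_of_injective _ hφ, Set.ncard_univ] at this
  simp at this

theorem bdd {n : ℕ} (P : SimpleGraph (Fin n) → Prop) :
    BddAbove {m : ℕ | ∃ G : SimpleGraph (Fin n), P G ∧ m = G.edgeSet.ncard} := by
  apply Set.Finite.bddAbove
  refine (Set.finite_range fun G : SimpleGraph (Fin n) => G.edgeSet.ncard).subset ?_
  rintro m ⟨G, -, rfl⟩
  exact ⟨G, rfl⟩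

theorem bdd1 (n k : ℕ) : BddAbove {m : ℕ | ∃ G : SimpleGraph (Fin n),
    IsOuterplanar G ∧ ¬ ContainsCopy (pathGraph k) G ∧ m = G.edgeSet.ncard} := by
  simpa only [and_assoc] using
    bdd (n := n) (fun G => IsOuterplanar G ∧ ¬ ContainsCopy (pathGraph k) G)

theorem le_exOP' {n k : ℕ} {G : SimpleGraph (Fin n)} (h1 : IsOuterplanar G) (h2 : G.Connected)
    (h3 : ¬ ContainsCopy (pathGraph k) G) : G.edgeSet.ncard ≤ exOP' n (pathGraph k) := by
  refine le_csSup ?_ ⟨G, h1, h2, h3, rfl⟩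
  simpa only [and_assoc] using
    bdd (n := n) (fun G => IsOuterplanar G ∧ G.Connected ∧ ¬ ContainsCopy (pathGraph k) G)

theorem le_exOP'' {n k : ℕ} {G : SimpleGraph (Fin n)} (h1 : IsOuterplanar G)
    (h2 : ∀ c : G.ConnectedComponent, c.supp.ncard ≤ k - 1)
    (h3 : ¬ ContainsCopy (pathGraph k) G) : G.edgeSet.ncard ≤ exOP'' n k (pathGraph k) := by
  refine le_csSup ?_ ⟨G, h1, h2, h3, rfl⟩
  simpa only [and_assoc] using
    bdd (n := n) (fun G => IsOuterplanar G ∧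
      (∀ c : G.ConnectedComponent, c.supp.ncard ≤ k - 1) ∧ ¬ ContainsCopy (pathGraph k) G)

end OPT

theorem exOP_path_eq_max (n k : ℕ) (hk : 4 ≤ k) (hn : k ≤ n) :
    exOP n (SimpleGraph.pathGraph k) =
      max (exOP' n (SimpleGraph.pathGraph k)) (exOP'' n k (SimpleGraph.pathGraph k)) := by
  apply le_antisymm
  · apply csSup_le'
    rintro m ⟨G, h1, h2, rfl⟩
    by_cases hc : ∀ c : G.ConnectedComponent, c.supp.ncard ≤ k - 1
    · exact (OPT.le_exOP'' h1 hc h2).trans (le_max_right _ _)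
    · push Not at hc
      obtain ⟨c, hc⟩ := hc
      by_cases h5 : k = 5
      · subst h5
        have a1 := OPT.five_bd' h1 h2
        have a2 := OPT.dia_edges n
        have a3 := OPT.le_exOP'' (k := 5) (OPT.dia_op n) (OPT.dia_comp n) (OPT.dia_free n)
        exact (a1.trans (a2.trans a3)).trans (le_max_right _ _)
      · obtain ⟨t, e, he, he1, hkt⟩ : ∃ t e, e + 1 ≤ t ∧ e ≤ 1 ∧ k = 2 * t + e + 2 :=
          ⟨(k - 2) / 2, k % 2, by omega, by omega, by omega⟩
        obtain ⟨m, b1, b2⟩ := OPT.big_bd h1 h2 he he1 hkt c (by omega)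
        have a2 := OPT.fan_edges n t e (by omega)
        have a3 := OPT.le_exOP' (k := k) (OPT.fan_op n t e) (OPT.fan_conn n t e (by omega))
          (OPT.fan_free n t e k (by omega) hkt)
        have a4 : (n - 2 - e) / t < m := by
          rw [Nat.div_lt_iff_lt_mul (by omega)]
          omega
        refine le_trans ?_ (le_max_left _ _)
        omega
  · apply max_le
    · apply csSup_le'
      rintro m ⟨G, h1, -, h2, rfl⟩
      exact le_csSup (OPT.bdd1 n k) ⟨G, h1, h2, rfl⟩
    · apply csSup_le'
      rintro m ⟨G, h1, -, h2, rfl⟩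
      exact le_csSup (OPT.bdd1 n k) ⟨G, h1, h2, rfl⟩
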